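/- The perimeter of the convex hull of a finite point set S ⊂ ℝ² is at most twice the total length of any spanning tree of S. -/

import Mathlib

open scoped Classical MeasureTheory
noncomputable section

/-- The Euclidean plane. -/
abbrev Pt : Type := EuclideanSpace ℝ (Fin 2)

/-- Perimeter of a plane region: 1-dimensional Hausdorff measure of its frontier. -/
noncomputable def perim (A : Set Pt) : ℝ := (μH[1] (frontier A)).toReal

/-- The Euclidean length of an (unordered) edge on points of `P`. -/
noncomputable def elen {P : Finset Pt} (e : Sym2 ↥P) : ℝ :=
  Sym2.lift ⟨fun (u v : ↥P) => dist (u : Pt) (v : Pt), fun _ _ => dist_comm _ _⟩ e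

/-- Total Euclidean length of the edges of a graph on the points of `P`. -/
noncomputable def glen {P : Finset Pt} (G : SimpleGraph ↥P) : ℝ := ∑ᶠ e ∈ G.edgeSet, elen e

/-- `T` is a Euclidean minimum spanning tree of `P`. -/
def IsEMST (P : Finset Pt) (T : SimpleGraph ↥P) : Prop :=
  T.IsTree ∧ ∀ T' : SimpleGraph ↥P, T'.IsTree → glen T ≤ glen T'

/-- Linear functional with coordinates `a`, `b`. -/
def lf (a b : ℝ) (x : Pt) : ℝ := a * x 0 + b * x 1

/-- Orientation determinant. -/
def cr (p q s : Pt) : ℝ := (q 0 - p 0) * (s 1 - p 1) - (q 1 - p 1) * (s 0 - p 0)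

/-- Oriented hull edge of `S`. -/
def IsHullEdge (S : Finset Pt) (p q : Pt) : Prop :=
  p ≠ q ∧ ∀ s ∈ S, 0 ≤ cr p q s ∧ (cr p q s = 0 → s ∈ segment ℝ p q)

def hullEdges (S : Finset Pt) : Finset (Pt × Pt) :=
  (S ×ˢ S).filter (fun e => IsHullEdge S e.1 e.2)

lemma pt_ext {x y : Pt} (h0 : x 0 = y 0) (h1 : x 1 = y 1) : x = y := by
  ext i; fin_cases i <;> assumption

lemma mem_seg_iff {p q x : Pt} : x ∈ segment ℝ p q ↔
    ∃ t : ℝ, 0 ≤ t ∧ t ≤ 1 ∧ x 0 = p 0 + t * (q 0 - p 0) ∧ x 1 = p 1 + t * (q 1 - p 1) := by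
  rw [segment_eq_image']
  constructor
  · rintro ⟨t, ⟨h0, h1⟩, rfl⟩
    exact ⟨t, h0, h1, by simp, by simp⟩
  · rintro ⟨t, h0, h1, e0, e1⟩
    exact ⟨t, ⟨h0, h1⟩, pt_ext (by simp [e0]) (by simp [e1])⟩

lemma exists_support {K : Set Pt} (hK : Convex ℝ K) (hc : IsClosed K) {x : Pt}
    (hx : x ∈ frontier K) :
    ∃ f : StrongDual ℝ Pt, f ≠ 0 ∧ ∀ y ∈ K, f y ≤ f x := by
  have hx' : x ∈ closure Kᶜ := by
    rw [frontier_eq_closure_inter_closure] at hx; exact hx.2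
  obtain ⟨y, hyK, hyx⟩ := mem_closure_iff_seq_limit.1 hx'
  have hxK : x ∈ K := hc.frontier_subset hx
  have key : ∀ k, ∃ f : StrongDual ℝ Pt, f ∈ Metric.sphere (0 : StrongDual ℝ Pt) 1 ∧
      ∀ z ∈ K, f z ≤ f (y k) := by
    intro k
    obtain ⟨f, u, h1, h2⟩ := geometric_hahn_banach_closed_point hK hc (hyK k)
    have hf : f ≠ 0 := by
      rintro rfl
      have := h1 x hxK
      simp at this h2
      linarith
    have hn : 0 < ‖f‖ := norm_pos_iff.2 hf
    refine ⟨‖f‖⁻¹ • f, ?_, ?_⟩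
    · simp [norm_smul, hn.ne']
    · intro z hz
      have := (h1 z hz).trans h2
      simp only [smul_apply, smul_eq_mul]
      gcongr
  choose f hf1 hf2 using key
  have : ProperSpace (StrongDual ℝ Pt) := FiniteDimensional.proper ℝ _
  obtain ⟨g, hg, φ, hφ, hlim⟩ :=
    (isCompact_sphere (0 : StrongDual ℝ Pt) 1).tendsto_subseq hf1
  refine ⟨g, ?_, ?_⟩
  · rintro rfl; simp at hg
  · intro z hz
    have t1 : Filter.Tendsto (fun k => (f (φ k)) z) Filter.atTop (nhds (g z)) :=
      (isBoundedBilinearMap_apply (𝕜 := ℝ) (E := Pt) (F := ℝ)).continuous.continuousAt.tendsto.comp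
        (hlim.prodMk_nhds tendsto_const_nhds)
    have t2 : Filter.Tendsto (fun k => (f (φ k)) (y (φ k))) Filter.atTop (nhds (g x)) :=
      (isBoundedBilinearMap_apply (𝕜 := ℝ) (E := Pt) (F := ℝ)).continuous.continuousAt.tendsto.comp
        (hlim.prodMk_nhds (hyx.comp hφ.tendsto_atTop))
    exact le_of_tendsto_of_tendsto' t1 t2 (fun k => hf2 _ z hz)

lemma exists_support' {K : Set Pt} (hK : Convex ℝ K) (hc : IsClosed K) {x : Pt}
    (hx : x ∈ frontier K) :
    ∃ a b : ℝ, 0 < a ^ 2 + b ^ 2 ∧ ∀ y ∈ K, lf a b y ≤ lf a b x := by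
  obtain ⟨f, hf, h⟩ := exists_support hK hc hx
  have hrep : ∀ y : Pt, f y = lf (f !₂[1, 0]) (f !₂[0, 1]) y := by
    intro y
    have : y = y 0 • (!₂[1, 0] : Pt) + y 1 • (!₂[0, 1] : Pt) :=
      pt_ext (by simp) (by simp)
    conv_lhs => rw [this]
    rw [map_add, map_smul, map_smul]; simp [lf, mul_comm]
  refine ⟨_, _, ?_, fun y hy => by rw [← hrep, ← hrep]; exact h y hy⟩
  by_contra hcon
  have h0 : f !₂[1, 0] = 0 := by
    nlinarith [sq_nonneg (f !₂[1, 0]), sq_nonneg (f !₂[0, 1])]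
  have h1 : f !₂[0, 1] = 0 := by
    nlinarith [sq_nonneg (f !₂[1, 0]), sq_nonneg (f !₂[0, 1])]
  apply hf
  ext y
  rw [hrep, h0, h1]; simp [lf]

lemma mem_seg_of_lf {a b : ℝ} (hab : 0 < a ^ 2 + b ^ 2) {p q x : Pt}
    (hpq : lf a b p = lf a b q) (hx : lf a b x = lf a b p)
    (h : lf (-b) a p < lf (-b) a q) (h1 : lf (-b) a p ≤ lf (-b) a x)
    (h2 : lf (-b) a x ≤ lf (-b) a q) : x ∈ segment ℝ p q := by
  set D := lf (-b) a q - lf (-b) a p with hD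
  have hDpos : 0 < D := by linarith
  have e0 : (x 0 - p 0) * D = (lf (-b) a x - lf (-b) a p) * (q 0 - p 0) := by
    have : (a ^ 2 + b ^ 2) * ((x 0 - p 0) * D - (lf (-b) a x - lf (-b) a p) * (q 0 - p 0)) = 0 := by
      simp only [hD, lf] at *
      linear_combination (a * (-b * q 0 + a * q 1 - (-b * p 0 + a * p 1))) * hx
        + (a * (-b * x 0 + a * x 1 - (-b * p 0 + a * p 1))) * hpq
    have := (mul_eq_zero.1 this).resolve_left hab.ne'
    linarith
  have e1 : (x 1 - p 1) * D = (lf (-b) a x - lf (-b) a p) * (q 1 - p 1) := by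
    have : (a ^ 2 + b ^ 2) * ((x 1 - p 1) * D - (lf (-b) a x - lf (-b) a p) * (q 1 - p 1)) = 0 := by
      simp only [hD, lf] at *
      linear_combination (b * (-b * q 0 + a * q 1 - (-b * p 0 + a * p 1))) * hx
        + (b * (-b * x 0 + a * x 1 - (-b * p 0 + a * p 1))) * hpq
    have := (mul_eq_zero.1 this).resolve_left hab.ne'
    linarith
  refine mem_seg_iff.2 ⟨(lf (-b) a x - lf (-b) a p) / D, by apply div_nonneg <;> linarith,
    by rw [div_le_one hDpos]; linarith, ?_, ?_⟩
  · field_simp; linarith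
  · field_simp; linarith

lemma eq_of_lf {a b : ℝ} (hab : 0 < a ^ 2 + b ^ 2) {p x : Pt}
    (h1 : lf a b x = lf a b p) (h2 : lf (-b) a x = lf (-b) a p) : x = p := by
  simp only [lf] at h1 h2
  apply pt_ext
  · apply mul_left_cancel₀ hab.ne'; linear_combination a * h1 - b * h2
  · apply mul_left_cancel₀ hab.ne'; linear_combination b * h1 + a * h2

lemma lf_linear (a b : ℝ) : IsLinearMap ℝ (lf a b) where
  map_add x y := by simp [lf]; ring
  map_smul c x := by simp [lf]; ring

lemma frontier_cover (S : Finset Pt) {x : Pt} (hx : x ∈ frontier (convexHull ℝ (S : Set Pt))) :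
    x ∈ S ∨ ∃ e ∈ hullEdges S, x ∈ segment ℝ e.1 e.2 := by
  have hclosed : IsClosed (convexHull ℝ (S : Set Pt)) :=
    (S.finite_toSet.isCompact_convexHull ℝ).isClosed
  have hxK := hclosed.frontier_subset hx
  obtain ⟨a, b, hab, hsup⟩ := exists_support' (convex_convexHull ℝ _) hclosed hx
  have hsupS : ∀ s ∈ S, lf a b s ≤ lf a b x := fun s hs => hsup s (subset_convexHull ℝ _ hs)
  set F := S.filter (fun s => lf a b s = lf a b x) with hF
  have hxF : x ∈ convexHull ℝ (F : Set Pt) := by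
    rw [Finset.mem_convexHull'] at hxK
    obtain ⟨w, hw0, hw1, hwx⟩ := hxK
    have hsum : ∑ s ∈ S, w s * (lf a b x - lf a b s) = 0 := by
      have : lf a b x = ∑ s ∈ S, w s * lf a b s := by
        conv_lhs => rw [← hwx]
        refine (map_sum ((lf_linear a b).mk') (fun y => w y • y) S).trans ?_
        exact Finset.sum_congr rfl fun s _ => (lf_linear a b).map_smul (w s) s
      simp only [mul_sub, Finset.sum_sub_distrib, ← Finset.sum_mul, hw1]
      linarith
    have hz := (Finset.sum_eq_zero_iff_of_nonneg (fun s hs =>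
      mul_nonneg (hw0 s hs) (sub_nonneg.2 (hsupS s hs)))).1 hsum
    have hoff : ∀ s ∈ S, s ∉ F → w s = 0 := by
      intro s hs hsF
      rcases mul_eq_zero.1 (hz s hs) with h | h
      · exact h
      · exact absurd (Finset.mem_filter.2 ⟨hs, by linarith⟩) hsF
    rw [Finset.mem_convexHull']
    refine ⟨w, fun s hs => hw0 s (Finset.mem_of_mem_filter s hs), ?_, ?_⟩
    · rw [← hw1]; exact Finset.sum_subset (Finset.filter_subset _ _) hoff
    · rw [← hwx]
      exact Finset.sum_subset (Finset.filter_subset _ _)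
        (fun s hs h => by rw [hoff s hs h, zero_smul])
  have hFne : F.Nonempty := by
    have := convexHull_nonempty_iff.1 ⟨x, hxF⟩
    exact_mod_cast this
  obtain ⟨p, hp, hpmin⟩ := F.exists_min_image (lf (-b) a) hFne
  obtain ⟨q, hq, hqmax⟩ := F.exists_max_image (lf (-b) a) hFne
  have hxp : lf (-b) a p ≤ lf (-b) a x := by
    have : convexHull ℝ (F : Set Pt) ⊆ {w | lf (-b) a p ≤ lf (-b) a w} :=
      convexHull_min (fun s hs => hpmin s hs) (convex_halfSpace_ge (lf_linear _ _) _)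
    exact this hxF
  have hxq : lf (-b) a x ≤ lf (-b) a q := by
    have : convexHull ℝ (F : Set Pt) ⊆ {w | lf (-b) a w ≤ lf (-b) a q} :=
      convexHull_min (fun s hs => hqmax s hs) (convex_halfSpace_le (lf_linear _ _) _)
    exact this hxF
  have hp' := Finset.mem_filter.1 hp
  have hq' := Finset.mem_filter.1 hq
  rcases (hxp.trans hxq).eq_or_lt with heq | hlt
  · left
    have : x = p := eq_of_lf hab hp'.2.symm (by linarith)
    rw [this]; exact hp'.1
  · right
    have hpq : lf a b p = lf a b q := hp'.2.trans hq'.2.symm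
    have hcr : ∀ s, (a ^ 2 + b ^ 2) * cr p q s =
        (lf (-b) a q - lf (-b) a p) * (lf a b x - lf a b s) := by
      intro s
      have h1 := hp'.2
      simp only [lf, cr] at *
      linear_combination (-(-b * (s 0 - p 0) + a * (s 1 - p 1))) * hpq +
        (-b * q 0 + a * q 1 - (-b * p 0 + a * p 1)) * h1
    refine ⟨(p, q), ?_, mem_seg_of_lf hab hpq hp'.2.symm hlt hxp hxq⟩
    refine Finset.mem_filter.2 ⟨Finset.mem_product.2 ⟨hp'.1, hq'.1⟩, ?_, ?_⟩
    · rintro h; simp only at h; rw [h] at hlt; exact lt_irrefl _ hlt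
    · intro s hs
      have hc := hcr s
      constructor
      · have : 0 ≤ (a ^ 2 + b ^ 2) * cr p q s := by
          rw [hc]; exact mul_nonneg (by linarith) (by linarith [hsupS s hs])
        exact nonneg_of_mul_nonneg_right this hab
      · intro h0
        simp only at h0
        rw [h0, mul_zero] at hc
        have hsx : lf a b s = lf a b x := by
          rcases mul_eq_zero.1 hc.symm with h | h <;> linarith
        have hsF : s ∈ F := Finset.mem_filter.2 ⟨hs, hsx⟩
        exact mem_seg_of_lf hab hpq (hsx.trans hp'.2.symm) hlt (hpmin s hsF) (hqmax s hsF)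

lemma lf_seg {a b : ℝ} {p q x : Pt} (h : x ∈ segment ℝ p q) (hpq : lf a b p < lf a b q) :
    lf a b p ≤ lf a b x ∧ lf a b x ≤ lf a b q ∧ (lf a b x = lf a b p → x = p) ∧
      (lf a b x = lf a b q → x = q) := by
  obtain ⟨t, h0, h1, e0, e1⟩ := mem_seg_iff.1 h
  have hx : lf a b x = lf a b p + t * (lf a b q - lf a b p) := by
    simp only [lf, e0, e1]; ring
  have hd : 0 < lf a b q - lf a b p := by linarith
  refine ⟨by nlinarith, by nlinarith, ?_, ?_⟩
  · intro h
    have : t = 0 := by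
      rcases mul_eq_zero.1 (show t * (lf a b q - lf a b p) = 0 by linarith) with h | h
      · exact h
      · linarith
    subst this
    exact pt_ext (by simp [e0]) (by simp [e1])
  · intro h
    have : t = 1 := by
      rcases mul_eq_zero.1 (show (t - 1) * (lf a b q - lf a b p) = 0 by linarith) with h | h
      · linarith
      · linarith
    subst this
    exact pt_ext (by simp [e0]) (by simp [e1])

lemma cr_zero_of_overlap {a b : ℝ} (hab : 0 < a ^ 2 + b ^ 2) {p q p' q' : Pt}
    (h : lf a b p < lf a b q) (h' : lf a b p' < lf a b q')
    (c1 : 0 ≤ cr p q p') (c2 : 0 ≤ cr p q q') (c1' : 0 ≤ cr p' q' p) (c2' : 0 ≤ cr p' q' q)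
    {t : ℝ} (ht : t ∈ Set.Ioo (lf a b p) (lf a b q)) (ht' : t ∈ Set.Ioo (lf a b p') (lf a b q')) :
    cr p q p' = 0 ∧ cr p q q' = 0 := by
  obtain ⟨l, hl0, hl1, hl⟩ : ∃ l : ℝ, 0 < l ∧ l < 1 ∧ t = lf a b p + l * (lf a b q - lf a b p) := by
    have hd : 0 < lf a b q - lf a b p := by linarith
    refine ⟨(t - lf a b p) / (lf a b q - lf a b p), div_pos (by linarith [ht.1]) hd,
      by rw [div_lt_one hd]; linarith [ht.2], by field_simp; ring⟩
  obtain ⟨m, hm0, hm1, hm⟩ : ∃ l : ℝ, 0 < l ∧ l < 1 ∧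
      t = lf a b p' + l * (lf a b q' - lf a b p') := by
    have hd : 0 < lf a b q' - lf a b p' := by linarith
    refine ⟨(t - lf a b p') / (lf a b q' - lf a b p'), div_pos (by linarith [ht'.1]) hd,
      by rw [div_lt_one hd]; linarith [ht'.2], by field_simp; ring⟩
  set g := (lf (-b) a p' + m * (lf (-b) a q' - lf (-b) a p')) -
    (lf (-b) a p + l * (lf (-b) a q - lf (-b) a p)) with hg
  have i1 : (a ^ 2 + b ^ 2) * ((1 - m) * cr p q p' + m * cr p q q') =
      (lf a b q - lf a b p) * g := by
    have e := hl.symm.trans hm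
    simp only [hg, lf, cr] at *
    linear_combination (-b * (q 0 - p 0) + a * (q 1 - p 1)) * e
  have i2 : (a ^ 2 + b ^ 2) * ((1 - l) * cr p' q' p + l * cr p' q' q) =
      (lf a b q' - lf a b p') * (-g) := by
    have e := hl.symm.trans hm
    simp only [hg, lf, cr] at *
    linear_combination -(-b * (q' 0 - p' 0) + a * (q' 1 - p' 1)) * e
  have n1 : 0 ≤ (1 - m) * cr p q p' := mul_nonneg (by linarith) c1
  have n2 : 0 ≤ m * cr p q q' := mul_nonneg hm0.le c2
  have n3 : 0 ≤ (1 - l) * cr p' q' p := mul_nonneg (by linarith) c1'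
  have n4 : 0 ≤ l * cr p' q' q := mul_nonneg hl0.le c2'
  have g1 : 0 ≤ g := by
    have : 0 ≤ (lf a b q - lf a b p) * g := by rw [← i1]; positivity
    exact nonneg_of_mul_nonneg_right this (by linarith)
  have g2 : 0 ≤ -g := by
    have : 0 ≤ (lf a b q' - lf a b p') * (-g) := by rw [← i2]; positivity
    exact nonneg_of_mul_nonneg_right this (by linarith)
  have g0 : g = 0 := by linarith
  rw [g0, mul_zero] at i1
  have := (mul_eq_zero.1 i1).resolve_left hab.ne'
  have z1 : (1 - m) * cr p q p' = 0 := by linarith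
  have z2 : m * cr p q q' = 0 := by linarith
  exact ⟨(mul_eq_zero.1 z1).resolve_left (by linarith), (mul_eq_zero.1 z2).resolve_left hm0.ne'⟩

lemma edge_sum_pos (S : Finset Pt) {a b : ℝ} (hab : 0 < a ^ 2 + b ^ 2) {m M : ℝ} (hmM : m ≤ M)
    (hb : ∀ s ∈ S, m ≤ lf a b s ∧ lf a b s ≤ M) :
    ∑ e ∈ hullEdges S, max (lf a b e.2 - lf a b e.1) 0 ≤ M - m := by
  set E := (hullEdges S).filter (fun e => lf a b e.1 < lf a b e.2) with hE
  have hmem : ∀ e ∈ E, e.1 ∈ S ∧ e.2 ∈ S ∧ IsHullEdge S e.1 e.2 ∧ lf a b e.1 < lf a b e.2 := by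
    intro e he
    simp only [hE, hullEdges, Finset.mem_filter, Finset.mem_product] at he
    tauto
  have hdisj : (E : Set (Pt × Pt)).PairwiseDisjoint
      (fun e => Set.Ioo (lf a b e.1) (lf a b e.2)) := by
    intro e he e' he' hne
    rw [Function.onFun, Set.disjoint_left]
    intro t ht ht'
    apply hne
    obtain ⟨hp, hq, ⟨_, hs⟩, hlt⟩ := hmem e he
    obtain ⟨hp', hq', ⟨_, hs'⟩, hlt'⟩ := hmem e' he'
    obtain ⟨z1, z2⟩ := cr_zero_of_overlap hab hlt hlt' (hs _ hp').1 (hs _ hq').1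
      (hs' _ hp).1 (hs' _ hq).1 ht ht'
    obtain ⟨z1', z2'⟩ := cr_zero_of_overlap hab hlt' hlt (hs' _ hp).1 (hs' _ hq).1
      (hs _ hp').1 (hs _ hq').1 ht' ht
    have A := lf_seg ((hs _ hp').2 z1) hlt
    have B := lf_seg ((hs _ hq').2 z2) hlt
    have A' := lf_seg ((hs' _ hp).2 z1') hlt'
    have B' := lf_seg ((hs' _ hq).2 z2') hlt'
    exact Prod.ext (A.2.2.1 (le_antisymm A'.1 A.1)).symm (B.2.2.2 (le_antisymm B.2.1 B'.2.1)).symm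
  have hvol : ∑ e ∈ E, ENNReal.ofReal (lf a b e.2 - lf a b e.1) ≤ ENNReal.ofReal (M - m) := by
    have h1 := MeasureTheory.measure_biUnion_finset (μ := MeasureTheory.volume) hdisj
      (fun e _ => measurableSet_Ioo)
    simp only [Real.volume_Ioo] at h1
    rw [← h1, ← Real.volume_Icc]
    apply MeasureTheory.measure_mono
    refine Set.iUnion₂_subset fun e he t ht => ?_
    obtain ⟨hp, hq, -, -⟩ := hmem e he
    exact ⟨(hb _ hp).1.trans ht.1.le, ht.2.le.trans (hb _ hq).2⟩
  rw [← ENNReal.ofReal_sum_of_nonneg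
    (fun e he => sub_nonneg.2 (hmem e he).2.2.2.le),
    ENNReal.ofReal_le_ofReal_iff (sub_nonneg.2 hmM)] at hvol
  refine le_trans (le_of_eq ?_) hvol
  rw [hE, Finset.sum_filter]
  refine Finset.sum_congr rfl fun e _ => ?_
  split_ifs with h
  · exact max_eq_left (by linarith)
  · exact max_eq_right (by linarith)

lemma edge_sum (S : Finset Pt) {a b : ℝ} (hab : 0 < a ^ 2 + b ^ 2) {m M : ℝ} (hmM : m ≤ M)
    (hb : ∀ s ∈ S, m ≤ lf a b s ∧ lf a b s ≤ M) :
    ∑ e ∈ hullEdges S, |lf a b e.2 - lf a b e.1| ≤ 2 * (M - m) := by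
  have h1 := edge_sum_pos S hab hmM hb
  have hneg : ∀ s, lf (-a) (-b) s = - lf a b s := fun s => by simp only [lf]; ring
  have h2 := edge_sum_pos S (a := -a) (b := -b) (by nlinarith) (m := -M) (M := -m) (by linarith)
    (fun s hs => by rw [hneg]; constructor <;> linarith [(hb s hs).1, (hb s hs).2])
  have : ∑ e ∈ hullEdges S, |lf a b e.2 - lf a b e.1| =
      ∑ e ∈ hullEdges S, max (lf a b e.2 - lf a b e.1) 0 +
      ∑ e ∈ hullEdges S, max (lf (-a) (-b) e.2 - lf (-a) (-b) e.1) 0 := by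
    rw [← Finset.sum_add_distrib]
    refine Finset.sum_congr rfl fun e _ => ?_
    rw [hneg, hneg]
    rcases le_total (lf a b e.2 - lf a b e.1) 0 with h | h
    · rw [abs_of_nonpos h, max_eq_right h, max_eq_left (by linarith)]; ring
    · rw [abs_of_nonneg h, max_eq_left h, max_eq_right (by linarith)]; ring
  linarith

/-- Projected length of an edge. -/
def plen {P : Finset Pt} (a b : ℝ) (e : Sym2 ↥P) : ℝ :=
  Sym2.lift ⟨fun (u v : ↥P) => |lf a b (u : Pt) - lf a b (v : Pt)|, fun _ _ => abs_sub_comm _ _⟩ e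

lemma plen_nonneg {P : Finset Pt} (a b : ℝ) (e : Sym2 ↥P) : 0 ≤ plen a b e := by
  induction e using Sym2.ind with
  | _ u v => exact abs_nonneg _

lemma walk_plen {P : Finset Pt} (a b : ℝ) {G : SimpleGraph ↥P} {u v : ↥P} (w : G.Walk u v) :
    |lf a b (u : Pt) - lf a b (v : Pt)| ≤ (w.edges.map (plen a b)).sum := by
  induction w with
  | nil => simp
  | @cons u v w h p ih =>
    simp only [SimpleGraph.Walk.edges_cons, List.map_cons, List.sum_cons]
    have : plen a b s(u, v) = |lf a b (u : Pt) - lf a b (v : Pt)| := rfl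
    rw [this]
    exact (abs_sub_le _ (lf a b (v : Pt)) _).trans (by linarith)

lemma tree_width {P : Finset Pt} (a b : ℝ) {G : SimpleGraph ↥P} (hG : G.Connected) (u v : ↥P) :
    |lf a b (u : Pt) - lf a b (v : Pt)| ≤ ∑ e ∈ G.edgeFinset, plen a b e := by
  obtain ⟨w, hw⟩ := (hG u v).exists_isPath
  refine (walk_plen a b w).trans ?_
  rw [← List.sum_toFinset _ hw.isTrail.edges_nodup]
  refine Finset.sum_le_sum_of_subset_of_nonneg ?_ (fun e _ _ => plen_nonneg a b e)
  intro e he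
  rw [List.mem_toFinset] at he
  exact SimpleGraph.mem_edgeFinset.2 (w.edges_subset_edgeSet he)

lemma pointwise {S : Finset Pt} (hS : S.Nonempty) {T : SimpleGraph ↥S} (hT : T.Connected)
    {a b : ℝ} (hab : 0 < a ^ 2 + b ^ 2) :
    ∑ e ∈ hullEdges S, |lf a b e.2 - lf a b e.1| ≤ 2 * ∑ e ∈ T.edgeFinset, plen a b e := by
  obtain ⟨p, hp, hpmin⟩ := S.exists_min_image (lf a b) hS
  obtain ⟨q, hq, hqmax⟩ := S.exists_max_image (lf a b) hS
  have h1 := edge_sum S hab (hpmin q hq) (fun s hs => ⟨hpmin s hs, hqmax s hs⟩)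
  have h2 := tree_width a b hT ⟨q, hq⟩ ⟨p, hp⟩
  have h3 := le_abs_self (lf a b q - lf a b p)
  simp only at h2
  linarith

/-- Crofton constant. -/
def croftonC : ℝ := ∫ θ in (0 : ℝ)..(2 * Real.pi), |Real.cos θ|

lemma croftonC_pos : 0 < croftonC := by
  unfold croftonC
  apply intervalIntegral.integral_pos (by positivity) (by fun_prop) (fun _ _ => abs_nonneg _)
  exact ⟨0, ⟨le_rfl, by positivity⟩, by simp⟩

lemma crofton (p q : Pt) :
    ∫ θ in (0 : ℝ)..(2 * Real.pi),
      |lf (Real.cos θ) (Real.sin θ) p - lf (Real.cos θ) (Real.sin θ) q| = croftonC * dist p q := by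
  set z : ℂ := ⟨p 0 - q 0, p 1 - q 1⟩ with hz
  have hn : dist p q = ‖z‖ := by
    rw [EuclideanSpace.dist_eq, Complex.norm_eq_sqrt_sq_add_sq]
    simp [Fin.sum_univ_two, Real.dist_eq, hz]
  have h0 : p 0 - q 0 = ‖z‖ * Real.cos z.arg := (Complex.norm_mul_cos_arg z).symm
  have h1 : p 1 - q 1 = ‖z‖ * Real.sin z.arg := (Complex.norm_mul_sin_arg z).symm
  have : ∀ θ : ℝ, |lf (Real.cos θ) (Real.sin θ) p - lf (Real.cos θ) (Real.sin θ) q| =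
      ‖z‖ * |Real.cos (θ - z.arg)| := by
    intro θ
    rw [← abs_of_nonneg (norm_nonneg z), ← abs_mul]
    congr 1
    rw [Real.cos_sub]; simp only [lf]
    linear_combination Real.cos θ * h0 + Real.sin θ * h1
  simp only [this]
  rw [intervalIntegral.integral_const_mul, hn, mul_comm,
    intervalIntegral.integral_comp_sub_right (fun x => |Real.cos x|) z.arg]
  congr 1
  have hper : Function.Periodic (fun x => |Real.cos x|) (2 * Real.pi) := by
    intro x; simp
  have := hper.intervalIntegral_add_eq (0 - z.arg) 0
  rw [croftonC]
  convert this using 2 <;> ring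

lemma lf_cont (p : Pt) : Continuous (fun θ : ℝ => lf (Real.cos θ) (Real.sin θ) p) := by
  unfold lf; fun_prop

lemma plen_cont {P : Finset Pt} (e : Sym2 ↥P) :
    Continuous (fun θ : ℝ => plen (Real.cos θ) (Real.sin θ) e) := by
  induction e using Sym2.ind with
  | _ u v => exact ((lf_cont u).sub (lf_cont v)).abs

lemma plen_int {P : Finset Pt} (e : Sym2 ↥P) :
    ∫ θ in (0 : ℝ)..(2 * Real.pi), plen (Real.cos θ) (Real.sin θ) e = croftonC * elen e := by
  induction e using Sym2.ind with
  | _ u v => exact crofton u v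

lemma hull_sum_le {S : Finset Pt} (hS : S.Nonempty) {T : SimpleGraph ↥S} (hT : T.Connected) :
    ∑ e ∈ hullEdges S, dist e.1 e.2 ≤ 2 * glen T := by
  have hg : glen T = ∑ e ∈ T.edgeFinset, elen e := by
    unfold glen
    rw [← SimpleGraph.coe_edgeFinset, finsum_mem_coe_finset]
  have hI : ∫ θ in (0 : ℝ)..(2 * Real.pi), ∑ e ∈ hullEdges S,
        |lf (Real.cos θ) (Real.sin θ) e.2 - lf (Real.cos θ) (Real.sin θ) e.1| ≤
      ∫ θ in (0 : ℝ)..(2 * Real.pi),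
        2 * ∑ e ∈ T.edgeFinset, plen (Real.cos θ) (Real.sin θ) e := by
    apply intervalIntegral.integral_mono (by positivity)
    · exact (continuous_finsetSum _ fun e _ =>
        ((lf_cont e.2).sub (lf_cont e.1)).abs).intervalIntegrable _ _
    · exact (continuous_const.mul
        (continuous_finsetSum _ fun e _ => plen_cont e)).intervalIntegrable _ _
    · intro θ
      exact pointwise hS hT (by rw [Real.cos_sq_add_sin_sq]; exact one_pos)
  rw [intervalIntegral.integral_const_mul, intervalIntegral.integral_finsetSum
    (fun e _ => ((lf_cont e.2).sub (lf_cont e.1)).abs.intervalIntegrable _ _),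
    intervalIntegral.integral_finsetSum
    (fun e _ => (plen_cont e).intervalIntegrable _ _)] at hI
  simp only [crofton, plen_int, ← Finset.mul_sum] at hI
  rw [← hg] at hI
  have : ∑ e ∈ hullEdges S, dist e.1 e.2 = ∑ e ∈ hullEdges S, dist e.2 e.1 :=
    Finset.sum_congr rfl fun e _ => dist_comm _ _
  rw [this]
  have hC := croftonC_pos
  nlinarith

lemma perim_le_hull_sum (S : Finset Pt) :
    perim (convexHull ℝ (S : Set Pt)) ≤ ∑ e ∈ hullEdges S, dist e.1 e.2 := by
  have h1 : μH[1] (frontier (convexHull ℝ (S : Set Pt))) ≤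
      ∑ e ∈ hullEdges S, edist e.1 e.2 := by
    have hsub : frontier (convexHull ℝ (S : Set Pt)) ⊆
        (S : Set Pt) ∪ ⋃ e ∈ hullEdges S, segment ℝ e.1 e.2 := by
      intro x hx
      rcases frontier_cover S hx with h | ⟨e, he, h⟩
      · exact Or.inl h
      · exact Or.inr (Set.mem_iUnion₂.2 ⟨e, he, h⟩)
    have hzero : μH[1] (S : Set Pt) = 0 := by
      have := MeasureTheory.Measure.nullSingletonClass_hausdorff Pt (d := 1) one_pos
      exact S.finite_toSet.measure_zero _
    refine (MeasureTheory.measure_mono hsub).trans ((MeasureTheory.measure_union_le _ _).trans ?_)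
    rw [hzero, zero_add]
    refine (MeasureTheory.measure_biUnion_finset_le _ _).trans (le_of_eq ?_)
    exact Finset.sum_congr rfl fun e _ => MeasureTheory.hausdorffMeasure_segment _ _
  unfold perim
  refine ENNReal.toReal_le_of_le_ofReal (Finset.sum_nonneg fun _ _ => dist_nonneg) ?_
  rw [ENNReal.ofReal_sum_of_nonneg (fun _ _ => dist_nonneg)]
  simpa only [edist_dist] using h1

/-- The perimeter of the convex hull of a finite point set `S ⊂ ℝ²`
(with at least two points) is at most twice the total length of any spanning tree of `S`. -/
theorem perim_convexHull_le_two_spanning_tree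
    (S : Finset Pt) (hS : 2 ≤ S.card)
    (T : SimpleGraph ↥S) (hT : T.IsTree) :
    perim (convexHull ℝ (S : Set Pt)) ≤ 2 * glen T := by
  exact (perim_le_hull_sum S).trans
    (hull_sum_le (Finset.card_pos.1 (by omega)) hT.1)
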